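/- For all integers n, m, j, ℓ with 1 ≤ m ≤ n, 1 ≤ j ≤ m−1, and ℓ ≥ m, one has Σ_{χ∈𝒳_m^{(ℓ)}} τ_j(χ) = m!·C(n,m)·Σ_{k=1}^{ℓ−m} j^k·S(ℓ−k−1, m−1). -/

import Mathlib

/-- `stirling2 a b` is the Stirling number of the second kind: the number of
partitions of an `a`-element set into `b` nonempty blocks. -/
def stirling2 : ℕ → ℕ → ℕ
  | 0, 0 => 1
  | 0, _ + 1 => 0
  | _ + 1, 0 => 0
  | a + 1, b + 1 => (b + 1) * stirling2 a (b + 1) + stirling2 a b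

/-- `pathSet n m ℓ` is the set `𝒳_m^{(ℓ)}` of sequences `(χ_1, …, χ_ℓ)` of length `ℓ`
with entries in an `n`-element set such that the set of entries has exactly `m` elements
and the last entry is distinct from all previous entries. -/
def pathSet (n m ℓ : ℕ) : Finset (Fin ℓ → Fin n) :=
  Finset.univ.filter (fun χ =>
    (Finset.image χ Finset.univ).card = m ∧
    ∀ t s : Fin ℓ, (t : ℕ) < ℓ - 1 → (s : ℕ) = ℓ - 1 → χ t ≠ χ s)

/-- `prior χ t` is the set `{χ_1, …, χ_{t−1}}` of values occurring strictly before
position `t` in the sequence `χ`. -/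
def prior {n ℓ : ℕ} (χ : Fin ℓ → Fin n) (t : Fin ℓ) : Finset (Fin n) :=
  (Finset.univ.filter (fun s => s < t)).image χ

/-- `tau j χ` is `τ_j(χ)`: the number of indices `t` with
`χ_t ∈ {χ_1, …, χ_{t−1}}` and `|{χ_1, …, χ_{t−1}}| = j`. -/
def tau {n ℓ : ℕ} (j : ℕ) (χ : Fin ℓ → Fin n) : ℕ :=
  (Finset.univ.filter (fun t => χ t ∈ prior χ t ∧ (prior χ t).card = j)).card

open Finset in
lemma sumSnoc {n L : ℕ} (F : (Fin (L+1) → Fin n) → ℕ) :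
    ∑ f, F f = ∑ g : Fin L → Fin n, ∑ x : Fin n, F (Fin.snoc (α := fun _ => Fin n) g x) := by
  rw [← (Fin.snocEquiv (fun _ : Fin (L+1) => Fin n)).sum_comp, Fintype.sum_prod_type,
    Finset.sum_comm]
  rfl

open Finset in
lemma imageSnoc {n L : ℕ} (g : Fin L → Fin n) (x : Fin n) :
    image (Fin.snoc (α := fun _ => Fin n) g x) univ = insert x (image g univ) := by
  ext y
  simp only [mem_image, mem_univ, true_and, mem_insert]
  rw [Fin.exists_fin_succ']
  simp only [Fin.snoc_castSucc, Fin.snoc_last]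
  rw [or_comm, eq_comm (a := x)]

open Finset in
lemma priorSnocCast {n L : ℕ} (g : Fin L → Fin n) (x : Fin n) (t : Fin L) :
    prior (Fin.snoc (α := fun _ => Fin n) g x) t.castSucc = prior g t := by
  ext y
  simp only [prior, mem_image, mem_filter, mem_univ, true_and]
  rw [Fin.exists_fin_succ']
  have : ¬ (Fin.last L < t.castSucc) := not_lt.2 (Fin.le_last _)
  simp [this]

open Finset in
lemma priorSnocLast {n L : ℕ} (g : Fin L → Fin n) (x : Fin n) :
    prior (Fin.snoc (α := fun _ => Fin n) g x) (Fin.last L) = image g univ := by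
  ext y
  simp only [prior, mem_image, mem_filter, mem_univ, true_and]
  rw [Fin.exists_fin_succ']
  simp [Fin.castSucc_lt_last]

open Finset in
lemma tauSnoc {n L : ℕ} (j : ℕ) (g : Fin L → Fin n) (x : Fin n) :
    tau j (Fin.snoc (α := fun _ => Fin n) g x)
      = tau j g + if x ∈ image g univ then (if (image g univ).card = j then 1 else 0) else 0 := by
  unfold tau
  rw [card_filter, card_filter, Fin.sum_univ_castSucc]
  simp only [priorSnocCast, priorSnocLast, Fin.snoc_castSucc, Fin.snoc_last]
  rw [ite_and]

open Finset in
lemma innerSum {n : ℕ} (A : Finset (Fin n)) (k t e : ℕ) :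
    ∑ x : Fin n, (if (insert x A).card = k + 1 then t + (if x ∈ A then e else 0) else 0)
      = (if A.card = k + 1 then (k+1) * (t + e) else 0)
        + (if A.card = k then (n - k) * t else 0) := by
  rw [← sum_add_sum_compl A]
  congr 1
  · rw [sum_congr rfl (g := fun _ => if A.card = k + 1 then t + e else 0)]
    · rw [sum_const, smul_eq_mul]
      split_ifs with h
      · rw [h]
      · simp
    · intro x hx
      simp [hx]
  · rw [sum_congr rfl (g := fun _ => if A.card = k then t else 0)]
    · rw [sum_const, smul_eq_mul, card_compl, Fintype.card_fin]
      split_ifs with h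
      · rw [h]
      · simp
    · intro x hx
      rw [mem_compl] at hx
      simp [hx]

open Finset in
/-- number of sequences with image of size k -/
def cnt (n L k : ℕ) : ℕ :=
  ∑ f : Fin L → Fin n, if (image f univ).card = k then 1 else 0

open Finset in
/-- sum of tau over sequences with image of size k -/
def tot (n j L k : ℕ) : ℕ :=
  ∑ f : Fin L → Fin n, if (image f univ).card = k then tau j f else 0

open Finset in
lemma cnt_succ (n L k : ℕ) :
    cnt n (L+1) (k+1) = (k+1) * cnt n L (k+1) + (n-k) * cnt n L k := by
  unfold cnt
  rw [sumSnoc, mul_sum, mul_sum, ← sum_add_distrib]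
  refine sum_congr rfl fun g _ => ?_
  simp only [imageSnoc]
  have := innerSum (image g univ) k 1 0
  simpa using this

open Finset in
lemma tot_succ (n j L k : ℕ) :
    tot n j (L+1) (k+1) = (k+1) * (tot n j L (k+1) + (if k + 1 = j then cnt n L (k+1) else 0))
      + (n-k) * tot n j L k := by
  have : (if k + 1 = j then cnt n L (k+1) else 0) = ∑ f : Fin L → Fin n,
      if (image f univ).card = k + 1 then (if (image f univ).card = j then 1 else 0) else 0 := by
    split_ifs with h
    · subst h
      unfold cnt
      refine sum_congr rfl fun g _ => ?_
      split_ifs <;> rfl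
    · symm
      refine sum_eq_zero fun g _ => ?_
      split_ifs <;> omega
  rw [this]
  unfold tot
  rw [sumSnoc, ← sum_add_distrib, mul_sum, mul_sum, ← sum_add_distrib]
  refine sum_congr rfl fun g _ => ?_
  simp only [imageSnoc, tauSnoc]
  rw [innerSum]
  congr 1
  · split_ifs <;> simp
  · split_ifs <;> simp

open Finset in
lemma image_card_succ {n L : ℕ} (f : Fin (L+1) → Fin n) : (image f univ).card ≠ 0 :=
  Finset.card_ne_zero.2 (univ_nonempty.image f)

lemma tot_succ_zero (n j L : ℕ) : tot n j (L+1) 0 = 0 := by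
  simp only [tot, image_card_succ, if_false, Finset.sum_const_zero]

lemma tot_zero (n j k : ℕ) : tot n j 0 k = 0 := by
  simp [tot, tau]

lemma cnt_eq (n L : ℕ) : ∀ k, cnt n L k = n.descFactorial k * stirling2 L k := by
  induction L with
  | zero =>
    intro k
    cases k <;> simp [cnt, stirling2]
  | succ L ih =>
    intro k
    cases k with
    | zero => simp only [cnt, image_card_succ, if_false, Finset.sum_const_zero, stirling2, mul_zero]
    | succ k =>
      rw [cnt_succ, ih, ih, stirling2, Nat.descFactorial_succ]
      ring

/-- geometric-Stirling sum -/
def uu (j : ℕ) : ℕ → ℕ → ℕ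
  | 0, _ => 0
  | L + 1, k => j * (stirling2 L k + uu j L k)

lemma uu_succ (j k : ℕ) (hj : 1 ≤ j) (L : ℕ) :
    uu j (L+1) (k+1) = (k+1) * uu j L (k+1) + uu j L k := by
  induction L with
  | zero => simp [uu, stirling2]
  | succ L ih =>
    have h1 : uu j (L+1+1) (k+1) = j * (stirling2 (L+1) (k+1) + uu j (L+1) (k+1)) := rfl
    have h2 : uu j (L+1) (k+1) = j * (stirling2 L (k+1) + uu j L (k+1)) := rfl
    have h3 : uu j (L+1) k = j * (stirling2 L k + uu j L k) := rfl
    rw [ih] at h1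
    rw [h1, h2, h3, stirling2]
    ring

lemma tot_eq (n j : ℕ) (hj : 1 ≤ j) (L : ℕ) :
    ∀ k, tot n j L k = if j ≤ k then n.descFactorial k * uu j L k else 0 := by
  induction L with
  | zero => intro k; simp [tot_zero, uu]
  | succ L ih =>
    intro k
    cases k with
    | zero => rw [tot_succ_zero, if_neg (by omega)]
    | succ k =>
      rw [tot_succ, ih, ih, cnt_eq]
      rcases lt_trichotomy (k+1) j with h | h | h
      · rw [if_neg (by omega), if_neg (by omega), if_neg (by omega), if_neg (by omega)]; simp
      · subst h
        rw [if_pos le_rfl, if_pos rfl, if_neg (by omega), if_pos le_rfl, uu]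
        ring
      · rw [if_pos (by omega), if_neg (by omega), if_pos (by omega), if_pos (by omega),
          uu_succ j k hj, Nat.descFactorial_succ]
        ring

lemma stirling2_lt : ∀ a b : ℕ, a < b → stirling2 a b = 0 := by
  intro a
  induction a with
  | zero => intro b hb; obtain ⟨c, rfl⟩ := Nat.exists_eq_succ_of_ne_zero hb.ne'; rfl
  | succ a ih =>
    intro b hb
    cases b with
    | zero => omega
    | succ b => rw [stirling2, ih _ (by omega), ih _ (by omega)]; simp

lemma uu_zero (j k : ℕ) : ∀ L, L ≤ k → uu j L k = 0 := by
  intro L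
  induction L with
  | zero => intro _; rfl
  | succ L ih => intro h; rw [uu, ih (by omega), stirling2_lt _ _ (by omega)]; rfl

lemma uu_eq (j k d : ℕ) :
    uu j (k + d) k = ∑ i ∈ Finset.Icc 1 d, j ^ i * stirling2 (k + d - i) k := by
  induction d with
  | zero => simp [uu_zero]
  | succ d ih =>
    rw [← add_assoc, uu, ih, mul_add, Finset.mul_sum,
      ← Finset.add_sum_Ioc_eq_sum_Icc (a := 1) (b := d + 1) (by omega)]
    congr 1
    · simp
    · refine Finset.sum_nbij' (fun i => i + 1) (fun i => i - 1) ?_ ?_ ?_ ?_ ?_ <;>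
        intro i hi <;> simp only [Finset.mem_Icc, Finset.mem_Ioc] at * <;> try omega
      rw [pow_succ, show k + d + 1 - (i + 1) = k + d - i by omega]
      ring

open Finset in
lemma pathSum (n j L k : ℕ) :
    ∑ χ ∈ pathSet n (k+1) (L+1), tau j χ = (n - k) * tot n j L k := by
  unfold pathSet tot
  rw [sum_filter, sumSnoc, mul_sum]
  refine sum_congr rfl fun g _ => ?_
  have h : ∀ x : Fin n, (∀ t s : Fin (L+1), (t : ℕ) < L + 1 - 1 → (s : ℕ) = L + 1 - 1 →
      (Fin.snoc (α := fun _ => Fin n) g x : Fin (L+1) → Fin n) t ≠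
      (Fin.snoc (α := fun _ => Fin n) g x : Fin (L+1) → Fin n) s) ↔ x ∉ image g univ := by
    intro x
    constructor
    · intro h hx
      obtain ⟨t, _, ht⟩ := mem_image.1 hx
      refine h t.castSucc (Fin.last L) (by simp) (by simp) ?_
      simp [ht]
    · intro h t s ht hs e
      obtain rfl : s = Fin.last L := Fin.ext (by simpa using hs)
      obtain ⟨t, rfl⟩ : ∃ t' : Fin L, t = t'.castSucc := ⟨⟨t, by simpa using ht⟩, rfl⟩
      rw [Fin.snoc_castSucc, Fin.snoc_last] at e
      exact h (mem_image.2 ⟨t, mem_univ _, e⟩)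
  simp only [h, imageSnoc, tauSnoc]
  rw [← sum_add_sum_compl (image g univ), sum_eq_zero, zero_add,
    sum_congr rfl (g := fun _ => if (image g univ).card = k then tau j g else 0)]
  · rw [sum_const, smul_eq_mul, card_compl, Fintype.card_fin]
    split_ifs with h
    · rw [h]
    · simp
  · intro x hx
    rw [mem_compl] at hx
    rw [card_insert_of_notMem hx, if_neg hx]
    simp only [hx, not_false_eq_true, and_true, add_left_inj, add_zero]
  · intro x hx
    rw [if_neg]
    exact fun h => h.2 hx

/-- `Σ_{χ∈𝒳_m^{(ℓ)}} τ_j(χ) = m!·C(n,m)·Σ_{k=1}^{ℓ−m} j^k·S(ℓ−k−1, m−1)`. -/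
theorem sum_tau_eq (n m j ℓ : ℕ) (hm : 1 ≤ m) (hmn : m ≤ n) (hj : 1 ≤ j)
    (hjm : j ≤ m - 1) (hℓ : m ≤ ℓ) :
    ∑ χ ∈ pathSet n m ℓ, tau j χ
      = m.factorial * n.choose m *
          ∑ k ∈ Finset.Icc 1 (ℓ - m), j ^ k * stirling2 (ℓ - k - 1) (m - 1) := by
  obtain ⟨k, rfl⟩ : ∃ k, m = k + 1 := ⟨m - 1, by omega⟩
  obtain ⟨d, rfl⟩ : ∃ d, ℓ = k + d + 1 := ⟨ℓ - (k + 1), by omega⟩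
  rw [pathSum, tot_eq n j hj, if_pos (by omega), uu_eq, ← Nat.descFactorial_eq_factorial_mul_choose,
    Nat.descFactorial_succ, mul_assoc, show k + d + 1 - (k + 1) = d by omega]
  congr 2
  refine Finset.sum_congr rfl fun i _ => ?_
  rw [show k + d + 1 - i - 1 = k + d - i by omega, Nat.add_sub_cancel]
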